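/- arXiv:1008.3095 — 2 statements merged into one kernel-verified Lean document; each statement's English description precedes it below -/
import Mathlib

section
/- Assume W is continuous and satisfies (H1). Then W satisfies (H2) and (H3) if and only if there exists a constant C* ≥ 1 such that C*⁻¹·min(|ξ−A|^p, |ξ−B|^p) ≤ W(ξ) ≤ C*·min(|ξ−A|^p, |ξ−B|^p) for every ξ ∈ ℝ^{3×3}. -/
open MeasureTheory Filter Topology ENNReal NNReal Set

noncomputable section

/-- Vectors in ℝ³. -/
abbrev V3 := Fin 3 → ℝ

/-- 3×3 matrices, represented as the triple of their columns. -/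
abbrev M33 := Fin 3 → V3

/-- Euclidean norm on ℝ³. -/
def vnorm (v : V3) : ℝ := Real.sqrt (∑ i, (v i) ^ 2)

/-- Frobenius (Euclidean) norm on 3×3 matrices. -/
def mnorm (ξ : M33) : ℝ := Real.sqrt (∑ j, ∑ i, (ξ j i) ^ 2)

/-- dist(ξ,{A,B}). -/
def mdist (A B ξ : M33) : ℝ := min (mnorm (ξ - A)) (mnorm (ξ - B))

/-- Spatial points of ℝ³ = ℝ × ℝ × ℝ. -/
abbrev Pt := ℝ × ℝ × ℝ

/-- Directional partial derivative of a map `u : ℝ³ → ℝ³`. -/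
def pd (e : Pt) (u : Pt → V3) (x : Pt) : V3 := fderiv ℝ u x e

def e1 : Pt := (1, 0, 0)
def e2 : Pt := (0, 1, 0)
def e3 : Pt := (0, 0, 1)

/-- Rescaled gradient ∇_h u = (∂₁u, ∂₂u, h⁻¹ ∂₃u), as a 3×3 matrix of columns. -/
def gradh (h : ℝ) (u : Pt → V3) (x : Pt) : M33 :=
  ![pd e1 u x, pd e2 u x, h⁻¹ • pd e3 u x]

/-- Squared rescaled Hessian |∇²_h u|². -/
def hessh (h : ℝ) (u : Pt → V3) (x : Pt) : ℝ :=
  (vnorm (pd e1 (pd e1 u) x)) ^ 2 + (vnorm (pd e2 (pd e2 u) x)) ^ 2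
    + (h⁻¹) ^ 4 * (vnorm (pd e3 (pd e3 u) x)) ^ 2
    + 2 * (vnorm (pd e2 (pd e1 u) x)) ^ 2
    + 2 * (h⁻¹) ^ 2 * (vnorm (pd e3 (pd e1 u) x)) ^ 2
    + 2 * (h⁻¹) ^ 2 * (vnorm (pd e3 (pd e2 u) x)) ^ 2

/-- The energy F^h_ε(u, S) = ∫_S (1/ε) W(∇_h u) + ε |∇²_h u|², valued in [0,∞]. -/
def F (W : M33 → ℝ) (h ε : ℝ) (u : Pt → V3) (S : Set Pt) : ℝ≥0∞ :=
  ∫⁻ x in S, ENNReal.ofReal (ε⁻¹ * W (gradh h u x) + ε * hessh h u x)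

/-- Hypothesis (H1): W ≥ 0, {W = 0} = {A, B}, A ≠ B, and A' − B' = 2 a ⊗ ν̄ for
some a ∈ ℝ³ and a unit vector ν̄ ∈ ℝ². -/
def H1 (W : M33 → ℝ) (A B : M33) : Prop :=
  (∀ ξ, 0 ≤ W ξ) ∧ (∀ ξ, W ξ = 0 ↔ ξ = A ∨ ξ = B) ∧ A ≠ B ∧
    ∃ (a : V3) (ν : ℝ × ℝ), ν.1 ^ 2 + ν.2 ^ 2 = 1 ∧
      A 0 - B 0 = (2 * ν.1) • a ∧ A 1 - B 1 = (2 * ν.2) • a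

/-- Hypothesis (H2): p-growth from above and below. -/
def H2 (W : M33 → ℝ) (p : ℝ) : Prop :=
  ∃ C > (0 : ℝ), ∀ ξ, C⁻¹ * (mnorm ξ) ^ p - C ≤ W ξ ∧ W ξ ≤ C * (mnorm ξ) ^ p + C

/-- Hypothesis (H3): non-degeneracy near the wells. -/
def H3 (W : M33 → ℝ) (A B : M33) (p : ℝ) : Prop :=
  ∃ ϱ > (0 : ℝ), ∃ C > (0 : ℝ), ∀ ξ, mdist A B ξ ≤ ϱ →
    C⁻¹ * (mdist A B ξ) ^ p ≤ W ξ ∧ W ξ ≤ C * (mdist A B ξ) ^ p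

/-- Hypothesis (H4): W(ξ₁, 0, ξ₃) ≤ W(ξ). -/
def H4 (W : M33 → ℝ) : Prop := ∀ ξ : M33, W ![ξ 0, 0, ξ 2] ≤ W ξ

/-- Normalization of the wells: A = −B, first column of A is a, second column is 0. -/
def Wells (A B : M33) (a : V3) : Prop := A = -B ∧ A 0 = a ∧ A 1 = 0

/-- ū₀(t) = |t| a. -/
def ub0 (a : V3) (t : ℝ) : V3 := |t| • a

/-- b̄₀(t) = A₃ for t ≥ 0, −A₃ (= B₃) for t < 0. -/
def bb0 (A3 : V3) (t : ℝ) : V3 := if 0 ≤ t then A3 else -A3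

/-- u₀(x) = ū₀(x₁). -/
def u0 (a : V3) (x : Pt) : V3 := ub0 a x.1

/-- b₀(x) = b̄₀(x₁). -/
def b0 (A3 : V3) (x : Pt) : V3 := bb0 A3 x.1

/-- The interval I = (−1/2, 1/2). -/
def II : Set ℝ := Set.Ioo (-(1 / 2 : ℝ)) (1 / 2)

/-- The unit cube Q = I × I × I. -/
def Q3 : Set Pt := II ×ˢ (II ×ˢ II)

/-- J_ρ = (ρ I) × J × I. -/
def Jrho (J : Set ℝ) (ρ : ℝ) : Set Pt := (Set.Ioo (-(ρ / 2)) (ρ / 2)) ×ˢ (J ×ˢ II)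

/-- The rescaled thin domain Ω = ω × I. -/
def Om (ω : Set (ℝ × ℝ)) : Set Pt := {x | (x.1, x.2.1) ∈ ω ∧ x.2.2 ∈ II}

/-- L¹ convergence on a set U. -/
def TendsL1 (U : Set Pt) (f : ℕ → Pt → V3) (g : Pt → V3) : Prop :=
  Tendsto (fun n => ∫⁻ x in U, ENNReal.ofReal (vnorm (f n x - g x))) atTop (nhds 0)

/-- L^q convergence on a set U. -/
def TendsLp (U : Set Pt) (q : ℝ) (f : ℕ → Pt → V3) (g : Pt → V3) : Prop :=
  Tendsto (fun n => ∫⁻ x in U, ENNReal.ofReal ((vnorm (f n x - g x)) ^ q)) atTop (nhds 0)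

/-- The localized asymptotic energy 𝓔_γ(J, ρ). -/
def Egam (W : M33 → ℝ) (a A3 : V3) (γ : ℝ) (J : Set ℝ) (ρ : ℝ) : ℝ≥0∞ :=
  sInf { L : ℝ≥0∞ | ∃ (h ε : ℕ → ℝ) (u : ℕ → Pt → V3),
    (∀ n, 0 < h n) ∧ (∀ n, 0 < ε n) ∧
    Tendsto h atTop (nhds 0) ∧ Tendsto ε atTop (nhds 0) ∧
    Tendsto (fun n => h n / ε n) atTop (nhds γ) ∧
    (∀ n, ContDiffOn ℝ 2 (u n) (Jrho J ρ)) ∧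
    TendsL1 (Jrho J ρ) u (u0 a) ∧
    TendsL1 (Jrho J ρ) (fun n x => (h n)⁻¹ • pd e3 (u n) x) (b0 A3) ∧
    L = Filter.liminf (fun n => F W (h n) (ε n) (u n) (Jrho J ρ)) atTop }

/-- K*_γ = 𝓔_γ(I, 1). -/
def Kstar (W : M33 → ℝ) (a A3 : V3) (γ : ℝ) : ℝ≥0∞ := Egam W a A3 γ II 1

/-- K*_∞ : the analogue of K*_γ for h/ε → ∞, on the unit cube Q. -/
def KstarInf (W : M33 → ℝ) (a A3 : V3) : ℝ≥0∞ :=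
  sInf { L : ℝ≥0∞ | ∃ (h ε : ℕ → ℝ) (u : ℕ → Pt → V3),
    (∀ n, 0 < h n) ∧ (∀ n, 0 < ε n) ∧
    Tendsto h atTop (nhds 0) ∧ Tendsto ε atTop (nhds 0) ∧
    Tendsto (fun n => h n / ε n) atTop atTop ∧
    (∀ n, ContDiffOn ℝ 2 (u n) Q3) ∧
    TendsL1 Q3 u (u0 a) ∧
    TendsL1 Q3 (fun n x => (h n)⁻¹ • pd e3 (u n) x) (b0 A3) ∧
    L = Filter.liminf (fun n => F W (h n) (ε n) (u n) Q3) atTop }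

open Classical in
/-- The phase matrix: B on E, A off E. -/
def Mfun (A B : M33) (E : Set (ℝ × ℝ)) (x' : ℝ × ℝ) : M33 := if x' ∈ E then B else A

/-! ### Two-dimensional objects -/

abbrev Pt2 := ℝ × ℝ

/-- Directional partial derivative of a map `v : ℝ² → ℝ³`. -/
def qd (e : Pt2) (v : Pt2 → V3) (y : Pt2) : V3 := fderiv ℝ v y e

def f1 : Pt2 := (1, 0)
def f2 : Pt2 := (0, 1)

/-- 𝒲(∇v) = W(∂₁v, 0, ∂₂v). -/
def W2 (W : M33 → ℝ) (v : Pt2 → V3) (y : Pt2) : ℝ := W ![qd f1 v y, 0, qd f2 v y]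

/-- Squared 2D Hessian |∇²v|². -/
def hess2d (v : Pt2 → V3) (y : Pt2) : ℝ :=
  (vnorm (qd f1 (qd f1 v) y)) ^ 2 + 2 * (vnorm (qd f2 (qd f1 v) y)) ^ 2
    + (vnorm (qd f2 (qd f2 v) y)) ^ 2

/-- The rectangle ℓI × γI. -/
def Rect (ℓ γ : ℝ) : Set Pt2 := Set.Ioo (-(ℓ / 2)) (ℓ / 2) ×ˢ Set.Ioo (-(γ / 2)) (γ / 2)

/-- The optimal-profile constant K_γ of the critical regime. -/
def Kgam (W : M33 → ℝ) (a A3 : V3) (γ : ℝ) : ℝ≥0∞ :=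
  sInf { L : ℝ≥0∞ | ∃ ℓ > (0 : ℝ), ∃ v : Pt2 → V3,
    ContDiffOn ℝ 2 v (Rect ℓ γ) ∧
    (∃ δ > (0 : ℝ), ∀ y ∈ Rect ℓ γ, ℓ / 2 - δ < y.1 → qd f1 v y = a ∧ qd f2 v y = A3) ∧
    (∃ δ > (0 : ℝ), ∀ y ∈ Rect ℓ γ, y.1 < -(ℓ / 2) + δ → qd f1 v y = -a ∧ qd f2 v y = -A3) ∧
    L = ENNReal.ofReal γ⁻¹ *
      ∫⁻ y in Rect ℓ γ, ENNReal.ofReal (W2 W v y + hess2d v y) }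

/-- The 2D subcritical functional F⁰_ε(u, b, D). -/
def F0 (W : M33 → ℝ) (ε : ℝ) (u b : Pt2 → V3) (D : Set Pt2) : ℝ≥0∞ :=
  ∫⁻ y in D, ENNReal.ofReal (ε⁻¹ * W ![qd f1 u y, qd f2 u y, b y]
    + ε * ((vnorm (qd f1 (qd f1 u) y)) ^ 2 + 2 * (vnorm (qd f2 (qd f1 u) y)) ^ 2
      + (vnorm (qd f2 (qd f2 u) y)) ^ 2
      + 2 * (vnorm (qd f1 b y)) ^ 2 + 2 * (vnorm (qd f2 b y)) ^ 2))

/-- K*₀: the subcritical cell constant. -/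
def Kstar0 (W : M33 → ℝ) (a A3 : V3) : ℝ≥0∞ :=
  sInf { L : ℝ≥0∞ | ∃ (ε : ℕ → ℝ) (u b : ℕ → Pt2 → V3),
    (∀ n, 0 < ε n) ∧ Tendsto ε atTop (nhds 0) ∧
    (∀ n, ContDiffOn ℝ 2 (u n) (II ×ˢ II)) ∧ (∀ n, ContDiffOn ℝ 1 (b n) (II ×ˢ II)) ∧
    Tendsto (fun n => ∫⁻ y in II ×ˢ II,
      ENNReal.ofReal (vnorm (u n y - ub0 a y.1) + vnorm (b n y - bb0 A3 y.1)))
      atTop (nhds 0) ∧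
    L = Filter.liminf (fun n => F0 W (ε n) (u n) (b n) (II ×ˢ II)) atTop }

/-- K₀: the subcritical optimal-profile constant. -/
def K0 (W : M33 → ℝ) (a A3 : V3) : ℝ≥0∞ :=
  sInf { L : ℝ≥0∞ | ∃ ℓ > (0 : ℝ), ∃ φ1 φ2 : ℝ → V3,
    ContDiffOn ℝ 1 φ1 (Set.Icc (-ℓ) ℓ) ∧ ContDiffOn ℝ 1 φ2 (Set.Icc (-ℓ) ℓ) ∧
    φ1 ℓ = a ∧ φ2 ℓ = A3 ∧ φ1 (-ℓ) = -a ∧ φ2 (-ℓ) = -A3 ∧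
    L = ∫⁻ t in Set.Ioo (-ℓ) ℓ, ENNReal.ofReal (W ![φ1 t, 0, φ2 t]
      + (vnorm (derivWithin φ1 (Set.Icc (-ℓ) ℓ) t)) ^ 2
      + 2 * (vnorm (derivWithin φ2 (Set.Icc (-ℓ) ℓ) t)) ^ 2) }

/-- K_∞ in the case λ = 0. -/
def KinfZero (W : M33 → ℝ) (a : V3) : ℝ≥0∞ :=
  sInf { L : ℝ≥0∞ | ∃ ℓ > (0 : ℝ), ∃ v : Pt2 → V3,
    ContDiff ℝ 2 v ∧ (∀ y : Pt2, v (y.1, y.2 + 1) = v y) ∧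
    (∃ δ > (0 : ℝ), ∀ y : Pt2, |y.1 - 1 / 2| < δ → qd f1 v y = a ∧ qd f2 v y = 0) ∧
    (∃ δ > (0 : ℝ), ∀ y : Pt2, |y.1 + 1 / 2| < δ → qd f1 v y = -a ∧ qd f2 v y = 0) ∧
    L = ∫⁻ y in II ×ˢ II, ENNReal.ofReal (ℓ * W2 W v y + ℓ⁻¹ * hess2d v y) }

/-- The unit normal ν_λ = (1+λ²)^{-1/2} (1, λ). -/
def nuv (lam : ℝ) : Pt2 := (1 / Real.sqrt (1 + lam ^ 2), lam / Real.sqrt (1 + lam ^ 2))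

/-- The orthogonal direction ν_λ^⊥ = (1+λ²)^{-1/2} (−λ, 1). -/
def nupv (lam : ℝ) : Pt2 := (-lam / Real.sqrt (1 + lam ^ 2), 1 / Real.sqrt (1 + lam ^ 2))

/-- Dot product on ℝ². -/
def dotp (w y : Pt2) : ℝ := w.1 * y.1 + w.2 * y.2

/-- The unit square Q'_λ centered at 0 with two sides orthogonal to ν_λ. -/
def Qlam (lam : ℝ) : Set Pt2 := {y | |dotp (nuv lam) y| < 1 / 2 ∧ |dotp (nupv lam) y| < 1 / 2}

/-- K_∞ for general λ. -/
def KinfL (W : M33 → ℝ) (a : V3) (lam : ℝ) : ℝ≥0∞ :=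
  ENNReal.ofReal (Real.sqrt (1 + lam ^ 2)) *
    sInf { L : ℝ≥0∞ | ∃ ℓ > (0 : ℝ), ∃ v : Pt2 → V3,
      ContDiff ℝ 2 v ∧ (∀ y : Pt2, v (y + nupv lam) = v y) ∧
      (∃ δ > (0 : ℝ), ∀ y : Pt2, |dotp (nuv lam) y - 1 / 2| < δ →
        qd f1 v y = a ∧ qd f2 v y = lam • a) ∧
      (∃ δ > (0 : ℝ), ∀ y : Pt2, |dotp (nuv lam) y + 1 / 2| < δ →
        qd f1 v y = -a ∧ qd f2 v y = -(lam • a)) ∧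
      L = ∫⁻ y in Qlam lam, ENNReal.ofReal (ℓ * W2 W v y + ℓ⁻¹ * hess2d v y) }

/-- Number of interfaces strictly below t. -/
def cnt (m : ℕ) (α : Fin m → ℝ) (t : ℝ) : ℕ := (Finset.univ.filter (fun i => α i < t)).card

end

/-- `mnorm` is the norm of the Euclidean space of families indexed by pairs. -/
theorem mnorm_eq_norm (ξ : M33) :
    mnorm ξ = ‖(WithLp.toLp 2 fun k : Fin 3 × Fin 3 => ξ k.1 k.2 :
      EuclideanSpace ℝ (Fin 3 × Fin 3))‖ := by
  simp [mnorm, EuclideanSpace.norm_eq, Fintype.sum_prod_type]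

theorem mnorm_nonneg (ξ : M33) : 0 ≤ mnorm ξ := Real.sqrt_nonneg _

theorem mnorm_add_le (ξ η : M33) : mnorm (ξ + η) ≤ mnorm ξ + mnorm η := by
  simp only [mnorm_eq_norm]
  exact norm_add_le (WithLp.toLp 2 fun k : Fin 3 × Fin 3 => ξ k.1 k.2 :
    EuclideanSpace ℝ (Fin 3 × Fin 3)) (WithLp.toLp 2 fun k => η k.1 k.2)

theorem mnorm_neg (ξ : M33) : mnorm (-ξ) = mnorm ξ := by
  simp [mnorm]

theorem mnorm_zero : mnorm 0 = 0 := by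
  simp [mnorm]

theorem continuous_mnorm : Continuous mnorm := by
  unfold mnorm
  fun_prop

theorem norm_le_mnorm (ξ : M33) : ‖ξ‖ ≤ mnorm ξ := by
  refine (pi_norm_le_iff_of_nonneg (mnorm_nonneg ξ)).2 fun j =>
    (pi_norm_le_iff_of_nonneg (mnorm_nonneg ξ)).2 fun i => ?_
  rw [mnorm_eq_norm]
  exact PiLp.norm_apply_le (WithLp.toLp 2 fun k : Fin 3 × Fin 3 => ξ k.1 k.2 :
    EuclideanSpace ℝ (Fin 3 × Fin 3)) (j, i)

theorem mdist_nonneg (A B ξ : M33) : 0 ≤ mdist A B ξ :=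
  le_min (mnorm_nonneg _) (mnorm_nonneg _)

theorem continuous_mdist (A B : M33) : Continuous (mdist A B) :=
  (continuous_mnorm.comp (continuous_id.sub continuous_const)).min
    (continuous_mnorm.comp (continuous_id.sub continuous_const))

theorem mdist_le_mnorm_add (A B ξ : M33) :
    mdist A B ξ ≤ mnorm ξ + (mnorm A + mnorm B) := by
  have h := mnorm_add_le ξ (-A)
  rw [mnorm_neg, ← sub_eq_add_neg] at h
  have := mnorm_nonneg B
  exact (min_le_left _ _).trans (by linarith)

theorem mnorm_le_mdist_add (A B ξ : M33) :
    mnorm ξ ≤ mdist A B ξ + (mnorm A + mnorm B) := by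
  have hA := mnorm_add_le (ξ - A) A
  have hB := mnorm_add_le (ξ - B) B
  rw [sub_add_cancel] at hA hB
  have := mnorm_nonneg A
  have := mnorm_nonneg B
  rcases min_choice (mnorm (ξ - A)) (mnorm (ξ - B)) with h | h <;>
    rw [mdist, h] <;> linarith

theorem min_rpow_eq_mdist_rpow {p : ℝ} (hp : 0 ≤ p) (A B ξ : M33) :
    min (mnorm (ξ - A) ^ p) (mnorm (ξ - B) ^ p) = mdist A B ξ ^ p := by
  rcases le_total (mnorm (ξ - A)) (mnorm (ξ - B)) with h | h
  · rw [mdist, min_eq_left h, min_eq_left (Real.rpow_le_rpow (mnorm_nonneg _) h hp)]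
  · rw [mdist, min_eq_right h, min_eq_right (Real.rpow_le_rpow (mnorm_nonneg _) h hp)]

theorem rpow_le_two_rpow_mul_add {p x y z : ℝ} (hp : 0 ≤ p) (hx : 0 ≤ x) (hy : 0 ≤ y)
    (hz : 0 ≤ z) (h : z ≤ x + y) : z ^ p ≤ 2 ^ p * (x ^ p + y ^ p) := by
  have hxp := Real.rpow_nonneg hx p
  have hyp := Real.rpow_nonneg hy p
  have h2 : (0 : ℝ) ≤ 2 ^ p := by positivity
  rcases le_total x y with hxy | hxy
  · calc z ^ p ≤ (2 * y) ^ p := Real.rpow_le_rpow hz (by linarith) hp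
      _ = 2 ^ p * y ^ p := Real.mul_rpow (by norm_num) hy
      _ ≤ _ := by gcongr; linarith
  · calc z ^ p ≤ (2 * x) ^ p := Real.rpow_le_rpow hz (by linarith) hp
      _ = 2 ^ p * x ^ p := Real.mul_rpow (by norm_num) hx
      _ ≤ _ := by gcongr; linarith

theorem isCompact_setOf_le_mdist_le (A B : M33) (r R : ℝ) :
    IsCompact {ξ | r ≤ mdist A B ξ ∧ mdist A B ξ ≤ R} := by
  refine Metric.isCompact_of_isClosed_isBounded ?_ ?_
  · exact (isClosed_le continuous_const (continuous_mdist A B)).inter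
      (isClosed_le (continuous_mdist A B) continuous_const)
  · refine (Metric.isBounded_closedBall (x := (0 : M33))
      (r := R + (mnorm A + mnorm B))).subset fun ξ hξ => ?_
    rw [mem_closedBall_zero_iff]
    have := norm_le_mnorm ξ
    have := mnorm_le_mdist_add A B ξ
    linarith [hξ.2]

theorem mdist_eq_zero_of_mem {A B ξ : M33} (h : ξ = A ∨ ξ = B) : mdist A B ξ = 0 := by
  rcases h with rfl | rfl <;> simp [mdist, mnorm_zero, mnorm_nonneg]

/-- A continuous function vanishing only at the wells is bounded below by a positive constant
at distances between `r > 0` and `R` from the wells. -/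
theorem exists_pos_le_of_le_mdist_le {W : M33 → ℝ} {A B : M33} (hW : Continuous W)
    (h1 : H1 W A B) {r : ℝ} (hr : 0 < r) (R : ℝ) :
    ∃ m > 0, ∀ ξ, r ≤ mdist A B ξ → mdist A B ξ ≤ R → m ≤ W ξ := by
  rcases Set.eq_empty_or_nonempty {ξ | r ≤ mdist A B ξ ∧ mdist A B ξ ≤ R} with he | hne
  · exact ⟨1, one_pos, fun ξ h h' =>
      absurd (show ξ ∈ {ξ | r ≤ mdist A B ξ ∧ mdist A B ξ ≤ R} from ⟨h, h'⟩) (by simp [he])⟩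
  · obtain ⟨η, hη, hmin⟩ :=
      (isCompact_setOf_le_mdist_le A B r R).exists_isMinOn hne hW.continuousOn
    refine ⟨W η, lt_of_le_of_ne (h1.1 η) fun h0 => ?_, fun ξ h h' => hmin ⟨h, h'⟩⟩
    have := mdist_eq_zero_of_mem ((h1.2.1 η).1 h0.symm)
    linarith [hη.1]

theorem exists_le_mul_mdist_rpow {p : ℝ} (hp : 0 < p) {A B : M33} {W : M33 → ℝ}
    (h2 : H2 W p) (h3 : H3 W A B p) : ∃ C > 0, ∀ ξ, W ξ ≤ C * mdist A B ξ ^ p := by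
  obtain ⟨C₁, hC₁, h2⟩ := h2
  obtain ⟨r, hr, C₂, hC₂, h3⟩ := h3
  have hK : 0 ≤ mnorm A + mnorm B := add_nonneg (mnorm_nonneg _) (mnorm_nonneg _)
  set k := (mnorm A + mnorm B) ^ p with hk
  have hk0 : 0 ≤ k := Real.rpow_nonneg hK p
  have hrp : 0 < r ^ p := Real.rpow_pos_of_pos hr p
  have h2p : (0 : ℝ) < 2 ^ p := by positivity
  set D := (C₁ * 2 ^ p * k + C₁) / r ^ p with hD
  have hD0 : 0 ≤ D := by positivity
  refine ⟨C₂ + C₁ * 2 ^ p + D, by positivity, fun ξ => ?_⟩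
  have hd := mdist_nonneg A B ξ
  have hdp := Real.rpow_nonneg hd p
  rcases le_total (mdist A B ξ) r with h | h
  · refine (h3 ξ h).2.trans (mul_le_mul_of_nonneg_right ?_ hdp)
    have : 0 ≤ C₁ * 2 ^ p := by positivity
    linarith
  · have hN := rpow_le_two_rpow_mul_add hp.le hd hK (mnorm_nonneg ξ) (mnorm_le_mdist_add A B ξ)
    have hrd : r ^ p ≤ mdist A B ξ ^ p := Real.rpow_le_rpow hr.le h hp.le
    have hDd : C₁ * 2 ^ p * k + C₁ ≤ D * mdist A B ξ ^ p := by
      calc C₁ * 2 ^ p * k + C₁ = D * r ^ p := by rw [hD, div_mul_cancel₀ _ hrp.ne']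
        _ ≤ _ := mul_le_mul_of_nonneg_left hrd hD0
    have := mul_le_mul_of_nonneg_left hN hC₁.le
    have := (h2 ξ).2
    have := mul_nonneg hC₂.le hdp
    rw [← hk] at hN
    linarith

theorem exists_mul_mdist_rpow_le {p : ℝ} (hp : 0 < p) {A B : M33} {W : M33 → ℝ}
    (hW : Continuous W) (h1 : H1 W A B) (h2 : H2 W p) (h3 : H3 W A B p) :
    ∃ c > 0, ∀ ξ, c * mdist A B ξ ^ p ≤ W ξ := by
  obtain ⟨C₁, hC₁, h2⟩ := h2
  obtain ⟨r, hr, C₂, hC₂, h3⟩ := h3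
  have hK : 0 ≤ mnorm A + mnorm B := add_nonneg (mnorm_nonneg _) (mnorm_nonneg _)
  set k := (mnorm A + mnorm B) ^ p with hk
  have hk0 : 0 ≤ k := Real.rpow_nonneg hK p
  have h2p : (0 : ℝ) < 2 ^ p := by positivity
  set M := 2 * 2 ^ p * (k + C₁ ^ 2) with hM
  have hM0 : 0 < M := by positivity
  obtain ⟨m, hm, hmW⟩ := exists_pos_le_of_le_mdist_le hW h1 hr (M ^ p⁻¹)
  set c₁ := (C₁ * (2 * 2 ^ p))⁻¹ with hc₁
  have hc₁0 : 0 < c₁ := by positivity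
  refine ⟨min C₂⁻¹ (min (m / M) c₁), by positivity, fun ξ => ?_⟩
  have hd := mdist_nonneg A B ξ
  have hdp := Real.rpow_nonneg hd p
  rcases le_total (mdist A B ξ) r with h | h
  · exact (mul_le_mul_of_nonneg_right (min_le_left _ _) hdp).trans (h3 ξ h).1
  refine (mul_le_mul_of_nonneg_right (min_le_right _ _) hdp).trans ?_
  rcases le_total (mdist A B ξ ^ p) M with hdM | hdM
  · refine (mul_le_mul_of_nonneg_right (min_le_left _ _) hdp).trans ?_
    calc m / M * mdist A B ξ ^ p ≤ m / M * M := by gcongr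
      _ = m := div_mul_cancel₀ _ hM0.ne'
      _ ≤ W ξ := hmW ξ h ((Real.le_rpow_inv_iff_of_pos hd hM0.le hp).2 hdM)
  · refine (mul_le_mul_of_nonneg_right (min_le_right _ _) hdp).trans (le_trans ?_ (h2 ξ).1)
    have hN := rpow_le_two_rpow_mul_add hp.le (mnorm_nonneg ξ) hK hd (mdist_le_mnorm_add A B ξ)
    rw [← hk] at hN
    have hsum : mdist A B ξ ^ p ≤ 2 * 2 ^ p * (mnorm ξ ^ p - C₁ ^ 2) := by
      rw [hM] at hdM
      linarith
    calc c₁ * mdist A B ξ ^ p ≤ c₁ * (2 * 2 ^ p * (mnorm ξ ^ p - C₁ ^ 2)) := by gcongr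
      _ = C₁⁻¹ * mnorm ξ ^ p - C₁ := by rw [hc₁]; field_simp

theorem H2_of_mdist_rpow_bounds {p : ℝ} (hp : 0 ≤ p) {A B : M33} {W : M33 → ℝ} {C : ℝ}
    (hC : 1 ≤ C)
    (h : ∀ ξ, C⁻¹ * mdist A B ξ ^ p ≤ W ξ ∧ W ξ ≤ C * mdist A B ξ ^ p) : H2 W p := by
  have hC0 : 0 < C := by linarith
  have hK : 0 ≤ mnorm A + mnorm B := add_nonneg (mnorm_nonneg _) (mnorm_nonneg _)
  set k := (mnorm A + mnorm B) ^ p with hk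
  have hk0 : 0 ≤ k := Real.rpow_nonneg hK p
  have h2p : (1 : ℝ) ≤ 2 ^ p := Real.one_le_rpow (by norm_num) hp
  have hC2 : 1 ≤ C * 2 ^ p := one_le_mul_of_one_le_of_one_le hC h2p
  refine ⟨C * 2 ^ p * (1 + k), by positivity, fun ξ => ⟨?_, ?_⟩⟩
  · have hN := rpow_le_two_rpow_mul_add hp (mdist_nonneg A B ξ) hK (mnorm_nonneg ξ)
      (mnorm_le_mdist_add A B ξ)
    have hNp := Real.rpow_nonneg (mnorm_nonneg ξ) p
    refine le_trans ?_ (h ξ).1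
    have hle : (C * 2 ^ p * (1 + k))⁻¹ ≤ (C * 2 ^ p)⁻¹ :=
      inv_anti₀ (by positivity) (le_mul_of_one_le_right (by positivity) (by linarith))
    have hCk : C⁻¹ * k ≤ C * 2 ^ p * (1 + k) := by
      have : C⁻¹ * k ≤ 1 * k := by gcongr; exact inv_le_one_of_one_le₀ hC
      nlinarith
    calc (C * 2 ^ p * (1 + k))⁻¹ * mnorm ξ ^ p - C * 2 ^ p * (1 + k)
        ≤ (C * 2 ^ p)⁻¹ * (2 ^ p * (mdist A B ξ ^ p + k)) - C⁻¹ * k :=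
          sub_le_sub (mul_le_mul hle hN hNp (by positivity)) hCk
      _ = C⁻¹ * mdist A B ξ ^ p := by field_simp; ring
  · have hN := rpow_le_two_rpow_mul_add hp (mnorm_nonneg ξ) hK (mdist_nonneg A B ξ)
      (mdist_le_mnorm_add A B ξ)
    have hNp := Real.rpow_nonneg (mnorm_nonneg ξ) p
    have hCN := mul_le_mul_of_nonneg_left hN hC0.le
    rw [← hk] at hCN
    have h0 : 0 ≤ C * 2 ^ p * (k * mnorm ξ ^ p + 1) := by positivity
    linarith [(h ξ).2]

/-- Lemma 3.1 / 4.6: under (H1), (H2) ∧ (H3) holds iff W is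
sandwiched between multiples of min(|ξ−A|^p, |ξ−B|^p). -/
theorem statement0 (p : ℝ) (hp : 2 ≤ p) (A B : M33) (W : M33 → ℝ)
    (hWc : Continuous W) (h1 : H1 W A B) :
    (H2 W p ∧ H3 W A B p) ↔
      ∃ C : ℝ, 1 ≤ C ∧ ∀ ξ : M33,
        C⁻¹ * min ((mnorm (ξ - A)) ^ p) ((mnorm (ξ - B)) ^ p) ≤ W ξ ∧
        W ξ ≤ C * min ((mnorm (ξ - A)) ^ p) ((mnorm (ξ - B)) ^ p) := by
  have hp0 : 0 < p := by linarith
  simp only [min_rpow_eq_mdist_rpow hp0.le]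
  constructor
  · rintro ⟨h2, h3⟩
    obtain ⟨C, -, hC⟩ := exists_le_mul_mdist_rpow hp0 h2 h3
    obtain ⟨c, hc, hcW⟩ := exists_mul_mdist_rpow_le hp0 hWc h1 h2 h3
    refine ⟨max 1 (max C c⁻¹), le_max_left _ _, fun ξ => ?_⟩
    have hdp := Real.rpow_nonneg (mdist_nonneg A B ξ) p
    refine ⟨(mul_le_mul_of_nonneg_right ?_ hdp).trans (hcW ξ),
      (hC ξ).trans (mul_le_mul_of_nonneg_right
        ((le_max_left _ _).trans (le_max_right _ _)) hdp)⟩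
    exact inv_le_of_inv_le₀ hc ((le_max_right _ _).trans (le_max_right _ _))
  · rintro ⟨C, hC, h⟩
    exact ⟨H2_of_mdist_rpow_bounds hp0.le hC h, 1, one_pos, C, by linarith, fun ξ _ => h ξ⟩
end

section
/- Assume W is continuous and satisfies (H1), (H2), (H3), and that the wells are A = −B with columns A = (a, 0, 0) for some a ∈ ℝ³∖{0} (so the third columns of A and B vanish). Then there exists a constant C_W > 0 such that W(ξ) ≥ C_W·|ξ₃|^p for every ξ = (ξ₁,ξ₂,ξ₃) ∈ ℝ^{3×3}, where ξ₃ denotes the third column of ξ. -/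
open MeasureTheory Filter Topology ENNReal NNReal Set

theorem vnorm_nonneg (v : V3) : 0 ≤ vnorm v := Real.sqrt_nonneg _

theorem vnorm_column_le_mnorm (ξ : M33) (j : Fin 3) : vnorm (ξ j) ≤ mnorm ξ :=
  Real.sqrt_le_sqrt <| Finset.single_le_sum
    (f := fun j => ∑ i, (ξ j i) ^ 2)
    (fun _ _ => Finset.sum_nonneg fun _ _ => sq_nonneg _) (Finset.mem_univ j)

theorem abs_le_vnorm (v : V3) (i : Fin 3) : |v i| ≤ vnorm v :=
  Real.abs_le_sqrt <| Finset.single_le_sum (f := fun i => (v i) ^ 2)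
    (fun _ _ => sq_nonneg _) (Finset.mem_univ i)

theorem isCompact_mnorm_le (R : ℝ) : IsCompact {ξ : M33 | mnorm ξ ≤ R} :=
  (isCompact_closedBall (0 : M33) R).of_isClosed_subset
    (isClosed_le continuous_mnorm continuous_const) fun ξ hξ => by
      simpa using (norm_le_mnorm ξ).trans hξ

/-- A column on which both wells vanish is controlled by the distance to the wells. -/
theorem vnorm_column_le_mdist {A B : M33} {j : Fin 3} (hA : A j = 0) (hB : B j = 0) (ξ : M33) :
    vnorm (ξ j) ≤ mdist A B ξ := by
  refine le_min ?_ ?_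
  · simpa [hA] using vnorm_column_le_mnorm (ξ - A) j
  · simpa [hB] using vnorm_column_le_mnorm (ξ - B) j

/-- Away from its zeros, a potential with `p`-growth is bounded below by a multiple of `|ξ|^p`. -/
theorem exists_mul_mnorm_rpow_le {W : M33 → ℝ} {A B : M33} {p ϱ : ℝ} (hp : 0 < p) (hϱ : 0 < ϱ)
    (hWc : Continuous W) (h1 : H1 W A B) (h2 : H2 W p) :
    ∃ c > (0 : ℝ), ∀ ξ, ϱ ≤ mdist A B ξ → c * mnorm ξ ^ p ≤ W ξ := by
  obtain ⟨hW0, hWz, -, -⟩ := h1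
  obtain ⟨C, hC, hgrowth⟩ := h2
  obtain ⟨m, hm, hmW⟩ := ((isCompact_mnorm_le ((2 * C ^ 2) ^ p⁻¹)).inter_right
    (isClosed_le continuous_const (continuous_mdist A B) : IsClosed {ξ | ϱ ≤ mdist A B ξ})
    ).exists_forall_le' hWc.continuousOn (a := 0) fun ξ hξ => by
      refine (hW0 ξ).lt_of_ne' fun h => hϱ.not_ge (hξ.2.trans ?_)
      rcases (hWz ξ).1 h with rfl | rfl
      · exact (min_le_left _ _).trans (by simp [mnorm_zero])
      · exact (min_le_right _ _).trans (by simp [mnorm_zero])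
  refine ⟨min (m / (2 * C ^ 2)) (2 * C)⁻¹, by positivity, fun ξ hξ => ?_⟩
  have hn : 0 ≤ mnorm ξ ^ p := Real.rpow_nonneg (mnorm_nonneg ξ) p
  rcases le_total (mnorm ξ ^ p) (2 * C ^ 2) with h | h
  · have hR : mnorm ξ ≤ (2 * C ^ 2) ^ p⁻¹ :=
      (Real.le_rpow_inv_iff_of_pos (mnorm_nonneg ξ) (by positivity) hp).2 h
    calc _ ≤ m / (2 * C ^ 2) * (2 * C ^ 2) :=
          mul_le_mul (min_le_left _ _) h hn (by positivity)
      _ = m := by field_simp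
      _ ≤ W ξ := hmW ξ ⟨hR, hξ⟩
  · calc _ ≤ (2 * C)⁻¹ * mnorm ξ ^ p := mul_le_mul_of_nonneg_right (min_le_right _ _) hn
      _ = C⁻¹ * mnorm ξ ^ p - (2 * C)⁻¹ * mnorm ξ ^ p := by field_simp; ring
      _ ≤ C⁻¹ * mnorm ξ ^ p - (2 * C)⁻¹ * (2 * C ^ 2) := by gcongr
      _ = C⁻¹ * mnorm ξ ^ p - C := by field_simp
      _ ≤ W ξ := (hgrowth ξ).1

/-- Lemma 6.2: if the third columns of the (opposite) wells vanish,
then W(ξ) ≥ C_W |ξ₃|^p. -/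
theorem statement2 (p : ℝ) (hp : 2 ≤ p) (A B : M33) (W : M33 → ℝ) (a : V3) (ha : a ≠ 0)
    (hWc : Continuous W) (h1 : H1 W A B) (h2 : H2 W p) (h3 : H3 W A B p)
    (hAB : A = -B) (hA0 : A 0 = a) (hA1 : A 1 = 0) (hA2 : A 2 = 0) :
    ∃ Cw > (0 : ℝ), ∀ ξ : M33, Cw * (vnorm (ξ 2)) ^ p ≤ W ξ := by
  have hp0 : 0 < p := by linarith
  have hB2 : B 2 = 0 := by simpa [hAB] using hA2
  obtain ⟨ϱ, hϱ, C, hC, hnear⟩ := h3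
  obtain ⟨c, hc, hfar⟩ := exists_mul_mnorm_rpow_le hp0 hϱ hWc h1 h2
  refine ⟨min C⁻¹ c, by positivity, fun ξ => ?_⟩
  have hv := vnorm_nonneg (ξ 2)
  rcases le_total (mdist A B ξ) ϱ with h | h
  · refine le_trans ?_ (hnear ξ h).1
    gcongr
    · exact min_le_left _ _
    · exact vnorm_column_le_mdist hA2 hB2 ξ
  · refine le_trans ?_ (hfar ξ h)
    gcongr
    · exact min_le_right _ _
    · exact vnorm_column_le_mnorm ξ 2
end
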